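/- Let K be a nondegenerate tetrahedron in ℝ³ and let σ ∈ Σ_K. If ∫_f σ n_f · v ds = 0 for every face f of K and every v ∈ P₁(f; ℝ³), and ∫_K σ dx = 0 (entrywise), then σ = 0 identically on K. (Unisolvence of the degrees of freedom for the shape function space Σ_K.) -/

import Mathlib

open MeasureTheory RealInnerProductSpace Matrix

noncomputable section

abbrev E3 := EuclideanSpace ℝ (Fin 3)

/-- `p` is (the restriction of) a real polynomial of total degree ≤ k on ℝ³. -/
def IsPolyLE (k : ℕ) (p : E3 → ℝ) : Prop :=
  ∃ P : MvPolynomial (Fin 3) ℝ, P.totalDegree ≤ k ∧ ∀ x, p x = MvPolynomial.eval (fun i => x i) P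

/-- `p` agrees with an affine function on the set `s`. -/
def AffineOn (s : Set E3) (p : E3 → ℝ) : Prop :=
  ∃ q : E3 →ᵃ[ℝ] ℝ, ∀ x ∈ s, p x = q x

def Tet (v : Fin 4 → E3) : Set E3 := convexHull ℝ (Set.range v)

def Face (v : Fin 4 → E3) (i : Fin 4) : Set E3 := convexHull ℝ (v '' {j | j ≠ i})

def Edge (v : Fin 4 → E3) (k l : Fin 4) : Set E3 := segment ℝ (v k) (v l)

/-- The matrix of the orthogonal projection `Q_u = I - u uᵀ` onto the plane `u^⊥`. -/
def Qmat (u : E3) : Matrix (Fin 3) (Fin 3) ℝ :=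
  1 - Matrix.vecMulVec (fun i => u i) (fun i => u i)

/-- Membership in the shape-function space
`Σ_K = {σ ∈ P₂(K;𝕊) : Q_{s_e} σ Q_{s_e}|_e ∈ P₁(e;𝕊) for every edge e of K}`. -/
def MemSigmaK (v : Fin 4 → E3) (σ : E3 → Matrix (Fin 3) (Fin 3) ℝ) : Prop :=
  (∀ i j : Fin 3, IsPolyLE 2 (fun x => σ x i j)) ∧
  (∀ x ∈ Tet v, (σ x).IsSymm) ∧
  (∀ k l : Fin 4, k ≠ l → ∀ s : E3, ‖s‖ = 1 → (∃ c : ℝ, v l - v k = c • s) →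
    ∀ i j : Fin 3, AffineOn (Edge v k l) (fun x => (Qmat s * σ x * Qmat s) i j))

/-- `n` is the outward unit normal to the face of the tetrahedron with vertices `v`
opposite the vertex `v i`. -/
def IsOutwardNormal (v : Fin 4 → E3) (i : Fin 4) (n : E3) : Prop :=
  ‖n‖ = 1 ∧ (∀ j k : Fin 4, j ≠ i → k ≠ i → ⟪v j - v k, n⟫ = 0) ∧
  (∀ j : Fin 4, j ≠ i → ⟪v i - v j, n⟫ < 0)



lemma polyint (a d0 d1 d2 d3 d4 d5 : ℝ) : ∫ x in (0:ℝ)..a, (d0 + d1*x + d2*x^2+d3*x^3+d4*x^4+d5*x^5) = d0*a+d1*a^2/2+d2*a^3/3+d3*a^4/4+d4*a^5/5+d5*a^6/6 := by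
  have h : ∀ x ∈ Set.uIcc 0 a, HasDerivAt (fun x : ℝ => d0*x+d1*x^2/2+d2*x^3/3+d3*x^4/4+d4*x^5/5+d5*x^6/6) (d0 + d1*x + d2*x^2+d3*x^3+d4*x^4+d5*x^5) x := by
    intro x _
    have e (n : ℕ) (d m : ℝ) : HasDerivAt (fun x : ℝ => d * x^n / m) (d * (n * x^(n-1)) / m) x :=
      ((hasDerivAt_pow n x).const_mul d).div_const m
    have := ((((((hasDerivAt_id x).const_mul d0).add (e 2 d1 2)).add (e 3 d2 3)).add (e 4 d3 4)).add (e 5 d4 5)).add (e 6 d5 6)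
    refine this.congr_deriv ?_
    push_cast
    ring
  rw [intervalIntegral.integral_eq_sub_of_hasDerivAt h]
  · simp
  · apply Continuous.intervalIntegrable; fun_prop

lemma fubini {Y : Type*} [TopologicalSpace Y] [MeasureSpace Y] [SecondCountableTopology Y] [BorelSpace Y] [IsLocallyFiniteMeasure (volume : Measure Y)] [SFinite (volume : Measure Y)] 
    (S : Set (ℝ × Y)) (hS : IsCompact S) (hSm : MeasurableSet S) (S' : ℝ → Set Y) (hS'm : ∀ x, MeasurableSet (S' x)) (a : ℝ) (ha : 0 ≤ a)
    (h : ∀ x y, (x,y) ∈ S ↔ x ∈ Set.Icc 0 a ∧ y ∈ S' x)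
    (f : ℝ × Y → ℝ) (hf : Continuous f) : ∫ z in S, f z = ∫ x in (0:ℝ)..a, ∫ y in S' x, f (x,y) := by
  have hi : IntegrableOn f S := hf.continuousOn.integrableOn_compact' hS hSm
  rw [← integral_indicator hSm, Measure.volume_eq_prod, integral_prod, intervalIntegral.integral_of_le ha,
    ← integral_Icc_eq_integral_Ioc, ← integral_indicator measurableSet_Icc]
  · congr 1
    funext x
    by_cases hx : x ∈ Set.Icc 0 a
    · rw [Set.indicator_of_mem hx, ← integral_indicator (hS'm x)]
      congr 1
      funext y
      by_cases hy : y ∈ S' x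
      · rw [Set.indicator_of_mem hy, Set.indicator_of_mem ((h x y).2 ⟨hx, hy⟩)]
      · rw [Set.indicator_of_notMem hy, Set.indicator_of_notMem]
        exact fun hh => hy ((h x y).1 hh).2
    · rw [Set.indicator_of_notMem hx]
      have : ∀ y, S.indicator f (x,y) = 0 := fun y => Set.indicator_of_notMem (fun hh => hx ((h x y).1 hh).1) _
      simp [this]
  · rw [← Measure.volume_eq_prod, integrable_indicator_iff hSm]; exact hi

def T2 (a : ℝ) : Set (ℝ × ℝ) := {z | 0 ≤ z.1 ∧ 0 ≤ z.2 ∧ z.1 + z.2 ≤ a}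
def T3 : Set (ℝ × ℝ × ℝ) := {z | 0 ≤ z.1 ∧ 0 ≤ z.2.1 ∧ 0 ≤ z.2.2 ∧ z.1 + z.2.1 + z.2.2 ≤ 1}

lemma T2_closed (a : ℝ) : IsClosed (T2 a) :=
  (isClosed_le continuous_const continuous_fst).and ((isClosed_le continuous_const continuous_snd).and
    (isClosed_le (continuous_fst.add continuous_snd) continuous_const))

lemma T3_closed : IsClosed T3 :=
  (isClosed_le continuous_const continuous_fst).and
    ((isClosed_le continuous_const continuous_snd.fst).and
    ((isClosed_le continuous_const continuous_snd.snd).and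
    (isClosed_le ((continuous_fst.add continuous_snd.fst).add continuous_snd.snd) continuous_const)))

lemma T2_compact (a : ℝ) : IsCompact (T2 a) := by
  refine (isCompact_Icc (a := ((0:ℝ),(0:ℝ))) (b := (a,a))).of_isClosed_subset (T2_closed a) ?_
  rintro ⟨x, y⟩ ⟨h1, h2, h3⟩
  simp only at h1 h2 h3
  exact ⟨⟨h1, h2⟩, ⟨by simp only; linarith, by simp only; linarith⟩⟩

lemma T3_compact : IsCompact T3 := by
  refine (isCompact_Icc (a := ((0:ℝ),(0:ℝ),(0:ℝ))) (b := (1,1,1))).of_isClosed_subset T3_closed ?_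
  rintro ⟨x, y, z⟩ ⟨h1, h2, h3, h4⟩
  simp only at h1 h2 h3 h4
  exact ⟨⟨h1, h2, h3⟩, ⟨by simp only; linarith, by simp only; linarith, by simp only; linarith⟩⟩

lemma T2_int (a : ℝ) (ha : 0 ≤ a) (c00 c10 c01 c20 c11 c02 c30 c21 c12 c03 : ℝ) :
    ∫ z in T2 a, (c00 + c10*z.1 + c01*z.2 + c20*z.1^2 + c11*z.1*z.2 + c02*z.2^2 + c30*z.1^3 + c21*z.1^2*z.2 + c12*z.1*z.2^2+c03*z.2^3)
     = c00*a^2/2 + (c10+c01)*a^3/6 + (c20+c02)*a^4/12 + c11*a^4/24 + (c30+c03)*a^5/20 + (c21+c12)*a^5/60 := by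
  rw [fubini (T2 a) (T2_compact a) (T2_closed a).measurableSet (fun x => Set.Icc 0 (a-x)) (fun x => measurableSet_Icc) a ha _ _ (by fun_prop)]
  · have h1 : ∀ x ∈ Set.uIcc 0 a, ∫ y in Set.Icc 0 (a-x), (c00 + c10*x + c01*y + c20*x^2 + c11*x*y + c02*y^2 + c30*x^3 + c21*x^2*y + c12*x*y^2+c03*y^3)
        = (c00+c10*x+c20*x^2+c30*x^3)*(a-x) + (c01+c11*x+c21*x^2)*(a-x)^2/2 + (c02+c12*x)*(a-x)^3/3+c03*(a-x)^4/4 := by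
      intro x hx
      rw [Set.uIcc_of_le ha] at hx
      rw [integral_Icc_eq_integral_Ioc, ← intervalIntegral.integral_of_le (by linarith [hx.2])]
      have := polyint (a-x) (c00+c10*x+c20*x^2+c30*x^3) (c01+c11*x+c21*x^2) (c02+c12*x) c03 0 0
      calc _ = _ := by congr 1; funext y; ring
        _ = _ := this
        _ = _ := by ring
    rw [intervalIntegral.integral_congr h1]
    have h2 := intervalIntegral.integral_comp_sub_left (a := 0) (b := a) (fun r => (c00+c10*(a-r)+c20*(a-r)^2+c30*(a-r)^3)*r + (c01+c11*(a-r)+c21*(a-r)^2)*r^2/2 + (c02+c12*(a-r))*r^3/3+c03*r^4/4) a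
    simp only [sub_sub_cancel, sub_self, sub_zero] at h2
    rw [h2]
    have := polyint a 0 (c00+c10*a+c20*a^2+c30*a^3) ((-c10-2*c20*a-3*c30*a^2)+(c01+c11*a+c21*a^2)/2) ((c20+3*c30*a)+(-c11-2*c21*a)/2+(c02+c12*a)/3) (-c30+c21/2-c12/3+c03/4) 0
    calc _ = _ := by congr 1; funext y; ring
      _ = _ := this
      _ = _ := by ring
  · intro x y
    simp only [T2, Set.mem_ofPred_eq, Set.mem_Icc]
    constructor
    · rintro ⟨h1, h2, h3⟩; refine ⟨⟨?_, ?_⟩, ?_, ?_⟩ <;> linarith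
    · rintro ⟨⟨h1, h2⟩, h3, h4⟩; refine ⟨?_, ?_, ?_⟩ <;> linarith

lemma T3_int (c0 c1 c2 c3 c11 c22 c33 c12 c13 c23 : ℝ) :
    ∫ z in T3, (c0 + c1*z.1 + c2*z.2.1 + c3*z.2.2 + c11*z.1^2 + c22*z.2.1^2 + c33*z.2.2^2 + c12*z.1*z.2.1+c13*z.1*z.2.2+c23*z.2.1*z.2.2)
     = c0/6 + (c1+c2+c3)/24+(c11+c22+c33)/60+(c12+c13+c23)/120 := by
  rw [fubini T3 T3_compact T3_closed.measurableSet (fun x => T2 (1-x)) (fun x => (T2_closed _).measurableSet) 1 zero_le_one _ _ (by fun_prop)]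
  · have h1 : ∀ x ∈ Set.uIcc (0:ℝ) 1, ∫ y in T2 (1-x), (c0 + c1*x + c2*y.1 + c3*y.2 + c11*x^2 + c22*y.1^2 + c33*y.2^2 + c12*x*y.1+c13*x*y.2+c23*y.1*y.2)
        = (c0+c1*x+c11*x^2)*(1-x)^2/2 + (c2+c3+c12*x+c13*x)*(1-x)^3/6+(c22+c33)*(1-x)^4/12+c23*(1-x)^4/24 := by
      intro x hx
      rw [Set.uIcc_of_le zero_le_one] at hx
      have := T2_int (1-x) (by linarith [hx.2]) (c0+c1*x+c11*x^2) (c2+c12*x) (c3+c13*x) c22 c23 c33 0 0 0 0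
      calc _ = _ := by congr 1; funext y; ring
        _ = _ := this
        _ = _ := by ring
    rw [intervalIntegral.integral_congr h1]
    have h2 := intervalIntegral.integral_comp_sub_left (a := 0) (b := 1) (fun r => (c0+c1*(1-r)+c11*(1-r)^2)*r^2/2 + (c2+c3+c12*(1-r)+c13*(1-r))*r^3/6+(c22+c33)*r^4/12+c23*r^4/24) 1
    simp only [sub_sub_cancel, sub_self, sub_zero] at h2
    rw [h2]
    have := polyint 1 0 0 ((c0+c1+c11)/2) ((-c1-2*c11)/2+(c2+c3+c12+c13)/6) (c11/2-(c12+c13)/6+(c22+c33)/12+c23/24) 0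
    calc _ = _ := by congr 1; funext y; ring
      _ = _ := this
      _ = _ := by ring
  · rintro x ⟨y, z⟩
    simp only [T2, T3, Set.mem_ofPred_eq, Set.mem_Icc]
    constructor
    · rintro ⟨h1, h2, h3, h4⟩; refine ⟨⟨?_, ?_⟩, ?_, ?_, ?_⟩ <;> linarith
    · rintro ⟨⟨h1, h2⟩, h3, h4, h5⟩; refine ⟨?_, ?_, ?_, ?_⟩ <;> linarith


lemma haar_pull {E F : Type*} [NormedAddCommGroup E] [NormedSpace ℝ E] [FiniteDimensional ℝ E] [MeasurableSpace E] [BorelSpace E]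
    [NormedAddCommGroup F] [NormedSpace ℝ F] [FiniteDimensional ℝ F] [MeasurableSpace F] [BorelSpace F]
    (μ : Measure E) [μ.IsAddHaarMeasure] (ν : Measure F) [ν.IsAddHaarMeasure] (L : E ≃ₗ[ℝ] F) (S : Set E) (f : F → ℝ)
    (h : ∫ x in L '' S, f x ∂ν = 0) : ∫ z in S, f (L z) ∂μ = 0 := by
  let L' : E ≃L[ℝ] F := L.toContinuousLinearEquiv
  have : (Measure.map L' μ).IsAddHaarMeasure := L'.isAddHaarMeasure_map μ
  have hE := Measure.isAddLeftInvariant_eq_smul (Measure.map L' μ) ν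
  have hm : MeasurableEmbedding L' := L'.toHomeomorph.measurableEmbedding
  have h2 := hm.setIntegral_map (μ := μ) f (L '' S)
  have h3 : (L' : E → F) ⁻¹' (L '' S) = S := by
    exact Set.preimage_image_eq S L.injective
  rw [h3, hE] at h2
  rw [show (∫ z in S, f (L z) ∂μ) = ∫ z in S, f (L' z) ∂μ from rfl, ← h2, Measure.restrict_smul]
  erw [integral_smul_nnreal_measure]
  rw [h, smul_zero]

lemma face_pull (L : ℝ × ℝ →ₗ[ℝ] E3) (hL : Function.Injective L) (p : E3) (S : Set (ℝ × ℝ)) (f : E3 → ℝ)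
    (h : ∫ x in (fun z => p + L z) '' S, f x ∂μH[2] = 0) : ∫ z in S, f (p + L z) = 0 := by
  let e := LinearEquiv.ofInjective L hL
  have hr : Module.finrank ℝ (LinearMap.range L) = 2 := by
    rw [← e.finrank_eq]; simp
  have : (μH[2] : Measure (LinearMap.range L)).IsAddHaarMeasure := by
    have := isAddHaarMeasure_hausdorffMeasure (E := LinearMap.range L)
    rw [hr] at this
    exact_mod_cast this
  let ι : LinearMap.range L → E3 := fun w => p + w
  have hι : Isometry ι := by
    refine Isometry.of_dist_eq fun x y => ?_
    simp [ι]
    rfl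
  have hm : MeasurableEmbedding ι := by
    have hc : Topology.IsClosedEmbedding ι := hι.isClosedEmbedding
    exact hc.measurableEmbedding
  have h1 := hι.map_hausdorffMeasure (d := 2) (Or.inl (by norm_num))
  have h2 := hm.setIntegral_map (μ := μH[2]) f (ι '' (e '' S))
  rw [Set.preimage_image_eq _ hι.injective, h1, Measure.restrict_restrict_of_subset (Set.image_subset_range _ _)] at h2
  have h3 : ι '' (e '' S) = (fun z => p + L z) '' S := by
    rw [Set.image_image]; rfl
  rw [h3, h] at h2
  exact haar_pull volume μH[2] e S (fun w => f (ι w)) h2.symm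
/-- Explicit quadratic functions on `E3`. -/
def IsQuad (p : E3 → ℝ) : Prop :=
  ∃ c0 c1 c2 c3 c4 c5 c6 c7 c8 c9 : ℝ, ∀ x : E3, p x = c0 + c1 * x 0 + c2 * x 1 + c3 * x 2
    + c4 * x 0 ^ 2 + c5 * x 1 ^ 2 + c6 * x 2 ^ 2 + c7 * x 0 * x 1 + c8 * x 0 * x 2 + c9 * x 1 * x 2

lemma IsQuad.zero : IsQuad (fun _ => 0) := ⟨0,0,0,0,0,0,0,0,0,0, fun x => by ring⟩

lemma IsQuad.add {p q : E3 → ℝ} (hp : IsQuad p) (hq : IsQuad q) : IsQuad (fun x => p x + q x) := by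
  obtain ⟨a0, a1, a2, a3, a4, a5, a6, a7, a8, a9, ha⟩ := hp
  obtain ⟨b0, b1, b2, b3, b4, b5, b6, b7, b8, b9, hb⟩ := hq
  refine ⟨a0+b0, a1+b1, a2+b2, a3+b3, a4+b4, a5+b5, a6+b6, a7+b7, a8+b8, a9+b9, fun x => ?_⟩
  simp only [ha, hb]; ring

lemma IsQuad.cmul {p : E3 → ℝ} (hp : IsQuad p) (c : ℝ) : IsQuad (fun x => c * p x) := by
  obtain ⟨a0, a1, a2, a3, a4, a5, a6, a7, a8, a9, ha⟩ := hp
  refine ⟨c*a0, c*a1, c*a2, c*a3, c*a4, c*a5, c*a6, c*a7, c*a8, c*a9, fun x => ?_⟩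
  simp only [ha]; ring

lemma IsQuad.sum {ι : Type*} (s : Finset ι) (p : ι → E3 → ℝ) (hp : ∀ i ∈ s, IsQuad (p i)) :
    IsQuad (fun x => ∑ i ∈ s, p i x) := by
  classical
  induction s using Finset.induction_on with
  | empty => simpa using IsQuad.zero
  | insert a s ha ih =>
    simp only [Finset.sum_insert ha]
    exact (hp a (Finset.mem_insert_self a s)).add (ih fun i hi => hp i (Finset.mem_insert_of_mem hi))

lemma IsPolyLE.isQuad {p : E3 → ℝ} (hp : IsPolyLE 2 p) : IsQuad p := by
  obtain ⟨P, hP, h⟩ := hp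
  have : p = fun x => ∑ s ∈ P.support, P.coeff s * ∏ i, (x i) ^ (s i) := by
    funext x
    rw [h, MvPolynomial.eval_eq']
  rw [this]
  apply IsQuad.sum
  intro s hs
  apply IsQuad.cmul
  have hd : s 0 + s 1 + s 2 ≤ 2 := by
    have := (MvPolynomial.le_totalDegree hs).trans hP
    rw [Finsupp.sum_fintype _ _ (fun _ => rfl), Fin.sum_univ_three] at this
    exact this
  simp only [Fin.prod_univ_three]
  generalize s 0 = a at *
  generalize s 1 = b at *
  generalize s 2 = c at *
  have ha : a ≤ 2 := by omega
  have hb : b ≤ 2 := by omega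
  have hc : c ≤ 2 := by omega
  interval_cases a <;> interval_cases b <;> interval_cases c <;> first | omega | skip
  · exact ⟨1,0,0,0,0,0,0,0,0,0, fun x => by ring⟩
  · exact ⟨0,0,0,1,0,0,0,0,0,0, fun x => by ring⟩
  · exact ⟨0,0,0,0,0,0,1,0,0,0, fun x => by ring⟩
  · exact ⟨0,0,1,0,0,0,0,0,0,0, fun x => by ring⟩
  · exact ⟨0,0,0,0,0,0,0,0,0,1, fun x => by ring⟩
  · exact ⟨0,0,0,0,0,1,0,0,0,0, fun x => by ring⟩
  · exact ⟨0,1,0,0,0,0,0,0,0,0, fun x => by ring⟩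
  · exact ⟨0,0,0,0,0,0,0,0,1,0, fun x => by ring⟩
  · exact ⟨0,0,0,0,0,0,0,1,0,0, fun x => by ring⟩
  · exact ⟨0,0,0,0,1,0,0,0,0,0, fun x => by ring⟩

/-- Scaled second difference along the segment from `u` to `w`. -/
def sd (p : E3 → ℝ) (u w : E3) : ℝ := 4 * p ((1/2 : ℝ) • u + (1/2 : ℝ) • w) - 2 * p u - 2 * p w

lemma sd_comm (p : E3 → ℝ) (u w : E3) : sd p u w = sd p w u := by
  unfold sd; rw [add_comm]; ring

lemma IsQuad.bary {p : E3 → ℝ} (hp : IsQuad p) (w0 w1 w2 w3 : E3) (x y z : ℝ) :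
    p (w0 + (x • (w1 - w0) + y • (w2 - w0) + z • (w3 - w0))) =
      (1-x-y-z) * p w0 + x * p w1 + y * p w2 + z * p w3
      + (1-x-y-z)*x*sd p w0 w1 + (1-x-y-z)*y*sd p w0 w2 + (1-x-y-z)*z*sd p w0 w3
      + x*y*sd p w1 w2 + x*z*sd p w1 w3 + y*z*sd p w2 w3 := by
  obtain ⟨a0, a1, a2, a3, a4, a5, a6, a7, a8, a9, ha⟩ := hp
  simp only [sd, ha, PiLp.add_apply, PiLp.smul_apply, PiLp.sub_apply, smul_eq_mul]
  ring

lemma IsQuad.bary2 {p : E3 → ℝ} (hp : IsQuad p) (w0 w1 w2 : E3) (x y : ℝ) :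
    p (w0 + (x • (w1 - w0) + y • (w2 - w0))) =
      (1-x-y) * p w0 + x * p w1 + y * p w2
      + (1-x-y)*x*sd p w0 w1 + (1-x-y)*y*sd p w0 w2 + x*y*sd p w1 w2 := by
  have := hp.bary w0 w1 w2 w2 x y 0
  simp only [zero_smul, add_zero] at this
  rw [this]; ring

def L2 (d1 d2 : E3) : ℝ × ℝ →ₗ[ℝ] E3 :=
  (LinearMap.toSpanSingleton ℝ E3 d1).coprod (LinearMap.toSpanSingleton ℝ E3 d2)

lemma L2_apply (d1 d2 : E3) (z : ℝ × ℝ) : L2 d1 d2 z = z.1 • d1 + z.2 • d2 := by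
  simp [L2]

def L3 (d1 d2 d3 : E3) : ℝ × ℝ × ℝ →ₗ[ℝ] E3 :=
  (LinearMap.toSpanSingleton ℝ E3 d1).coprod (L2 d2 d3)

lemma L3_apply (d1 d2 d3 : E3) (z : ℝ × ℝ × ℝ) : L3 d1 d2 d3 z = z.1 • d1 + z.2.1 • d2 + z.2.2 • d3 := by
  simp [L3, L2_apply, add_assoc]

lemma T2_convex : Convex ℝ (T2 1) := by
  rintro ⟨x, y⟩ ⟨h1, h2, h3⟩ ⟨x', y'⟩ ⟨h1', h2', h3'⟩ a b ha hb hab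
  simp only at *
  refine ⟨?_, ?_, ?_⟩ <;> simp only [Prod.smul_mk, Prod.mk_add_mk, smul_eq_mul]
  · positivity
  · positivity
  · nlinarith

lemma hull3 (w0 w1 w2 : E3) : convexHull ℝ {w0, w1, w2} = (fun z => w0 + L2 (w1-w0) (w2-w0) z) '' T2 1 := by
  apply Set.Subset.antisymm
  · apply convexHull_min
    · rintro x (rfl | rfl | rfl)
      · exact ⟨(0,0), by simp [T2], by simp [L2_apply]⟩
      · exact ⟨(1,0), by simp [T2], by simp [L2_apply]⟩
      · exact ⟨(0,1), by simp [T2], by simp [L2_apply]⟩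
    · have := (T2_convex.linear_image (L2 (w1-w0) (w2-w0))).translate w0
      rwa [Set.image_image] at this
  · rintro _ ⟨⟨x, y⟩, ⟨h1, h2, h3⟩, rfl⟩
    simp only at h1 h2 h3
    have := (convex_convexHull ℝ ({w0, w1, w2} : Set E3)).sum_mem (t := Finset.univ) (w := ![1-x-y,x,y]) (z := ![w0,w1,w2])
      (by intro i _; fin_cases i <;> simp <;> linarith) (by simp [Fin.sum_univ_three]; ring)
      (by intro i _; apply subset_convexHull; fin_cases i <;> simp)
    convert this using 1
    simp only [L2_apply, Fin.sum_univ_three]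
    simp
    module

lemma tet_hull (w0 w1 w2 w3 : E3) (b : AffineBasis (Fin 4) ℝ E3) (h0 : b 0 = w0) (h1 : b 1 = w1) (h2 : b 2 = w2) (h3 : b 3 = w3) :
    convexHull ℝ (Set.range b) = (fun z => w0 + L3 (w1-w0) (w2-w0) (w3-w0) z) '' T3 := by
  have key : ∀ z : ℝ × ℝ × ℝ, w0 + L3 (w1-w0) (w2-w0) (w3-w0) z = (Finset.univ.affineCombination ℝ b) ![1-z.1-z.2.1-z.2.2, z.1, z.2.1, z.2.2] := by
    intro z
    rw [Finset.affineCombination_eq_linear_combination]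
    · simp [Fin.sum_univ_four, L3_apply, h0, h1, h2, h3]; module
    · simp [Fin.sum_univ_four]; ring
  have hs : ∀ z : ℝ × ℝ × ℝ, ∑ i, (![1-z.1-z.2.1-z.2.2, z.1, z.2.1, z.2.2] : Fin 4 → ℝ) i = 1 := by
    intro z; simp [Fin.sum_univ_four]; ring
  rw [b.convexHull_eq_nonneg_coord]
  ext x
  constructor
  · intro hx
    refine ⟨(b.coord 1 x, b.coord 2 x, b.coord 3 x), ?_, ?_⟩
    · have := b.sum_coord_apply_eq_one x
      rw [Fin.sum_univ_four] at this
      have h0 := hx 0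
      refine ⟨hx 1, hx 2, hx 3, ?_⟩
      simp only; linarith
    · simp only
      have hs := b.sum_coord_apply_eq_one x
      rw [Fin.sum_univ_four] at hs
      have := b.linear_combination_coord_eq_self x
      rw [Fin.sum_univ_four, h0, h1, h2, h3, show b.coord 0 x = 1 - b.coord 1 x - b.coord 2 x - b.coord 3 x by linarith] at this
      conv_rhs => rw [← this]
      rw [L3_apply]; module
  · rintro ⟨z, ⟨g1, g2, g3, g4⟩, rfl⟩ i
    simp only [key]
    rw [b.coord_apply_combination_of_mem (Finset.mem_univ i) (hs z)]
    fin_cases i <;> simp <;> linarith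

/-- Face moments. -/
lemma face_lemma {p : E3 → ℝ} (hp : IsQuad p) (w0 w1 w2 : E3) (q1 q2 : E3 →ᵃ[ℝ] ℝ)
    (h10 : q1 w0 = 0) (h11 : q1 w1 = 1) (h12 : q1 w2 = 0)
    (h20 : q2 w0 = 0) (h21 : q2 w1 = 0) (h22 : q2 w2 = 1)
    (h : ∀ q : E3 →ᵃ[ℝ] ℝ, ∫ x in convexHull ℝ {w0, w1, w2}, p x * q x ∂μH[2] = 0) :
    20 * p w0 = -(3 * sd p w0 w1 + 3 * sd p w0 w2 - sd p w1 w2) := by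
  have e (q : E3 →ᵃ[ℝ] ℝ) (z : ℝ × ℝ) : q (w0 + L2 (w1-w0) (w2-w0) z) = q w0 + z.1 * (q w1 - q w0) + z.2 * (q w2 - q w0) := by
    rw [L2_apply, add_comm w0, ← vadd_eq_add, AffineMap.map_vadd, map_add, map_smul, map_smul, ← vsub_eq_sub, ← vsub_eq_sub,
      AffineMap.linearMap_vsub, AffineMap.linearMap_vsub]
    simp; ring
  have hinj : Function.Injective (L2 (w1-w0) (w2-w0)) := by
    intro z z' hz
    have a1 := e q1 z
    have a2 := e q2 z
    rw [hz, e] at a1 a2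
    rw [h10, h11, h12] at a1
    rw [h20, h21, h22] at a2
    ext <;> linarith
  have key (q : E3 →ᵃ[ℝ] ℝ) := face_pull _ hinj w0 (T2 1) (fun x => p x * q x) (by rw [← hull3]; exact h q)
  simp only [e] at key
  simp only [L2_apply, hp.bary2] at key
  have k0 := key (AffineMap.const ℝ E3 1)
  have k1 := key q1
  have k2 := key q2
  simp only [h10, h11, h12, h20, h21, h22, AffineMap.const_apply] at k0 k1 k2
  set b0 := p w0
  set b1 := p w1
  set b2 := p w2
  set a01 := sd p w0 w1
  set a02 := sd p w0 w2
  set a12 := sd p w1 w2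
  have i0 := T2_int 1 zero_le_one b0 (b1-b0+a01) (b2-b0+a02) (-a01) (a12-a01-a02) (-a02) 0 0 0 0
  have i1 := T2_int 1 zero_le_one 0 b0 0 (b1-b0+a01) (b2-b0+a02) 0 (-a01) (a12-a01-a02) (-a02) 0
  have i2 := T2_int 1 zero_le_one 0 0 b0 0 (b1-b0+a01) (b2-b0+a02) 0 (-a01) (a12-a01-a02) (-a02)
  have j0 := k0.symm.trans (Eq.trans (by congr 1; funext y; ring) i0)
  have j1 := k1.symm.trans (Eq.trans (by congr 1; funext y; ring) i1)
  have j2 := k2.symm.trans (Eq.trans (by congr 1; funext y; ring) i2)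
  linarith

lemma tet_lemma {p : E3 → ℝ} (hp : IsQuad p) (b : AffineBasis (Fin 4) ℝ E3)
    (h : ∫ x in convexHull ℝ (Set.range b), p x = 0) :
    5 * (p (b 0) + p (b 1) + p (b 2) + p (b 3)) + (sd p (b 0) (b 1) + sd p (b 0) (b 2) + sd p (b 0) (b 3)
      + sd p (b 1) (b 2) + sd p (b 1) (b 3) + sd p (b 2) (b 3)) = 0 := by
  have e (q : E3 →ᵃ[ℝ] ℝ) (z : ℝ × ℝ × ℝ) : q (b 0 + L3 (b 1-b 0) (b 2-b 0) (b 3-b 0) z) =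
      q (b 0) + z.1 * (q (b 1) - q (b 0)) + z.2.1 * (q (b 2) - q (b 0)) + z.2.2 * (q (b 3) - q (b 0)):= by
    rw [L3_apply, add_comm (b 0), ← vadd_eq_add, AffineMap.map_vadd, map_add, map_add, map_smul, map_smul, map_smul,
      ← vsub_eq_sub, ← vsub_eq_sub, ← vsub_eq_sub,
      AffineMap.linearMap_vsub, AffineMap.linearMap_vsub, AffineMap.linearMap_vsub]
    simp; ring
  have hinj : Function.Injective (L3 (b 1-b 0) (b 2-b 0) (b 3-b 0)) := by
    intro z z' hz
    have a1 := e (b.coord 1) z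
    have a2 := e (b.coord 2) z
    have a3 := e (b.coord 3) z
    rw [hz, e] at a1 a2 a3
    simp at a1 a2 a3
    ext <;> simp [a1, a2, a3]
  have hbij : Function.Bijective (L3 (b 1-b 0) (b 2-b 0) (b 3-b 0)) :=
    ⟨hinj, (LinearMap.injective_iff_surjective_of_finrank_eq_finrank (by simp)).1 hinj⟩
  let Le := LinearEquiv.ofBijective _ hbij
  have h0 : ∫ x in Le '' T3, p (b 0 + x) = 0 := by
    have hm : MeasurableEmbedding (fun x : E3 => b 0 + x) := (Homeomorph.addLeft (b 0)).measurableEmbedding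
    have := hm.setIntegral_map (μ := volume) p ((fun x : E3 => b 0 + x) '' (Le '' T3))
    rw [Set.preimage_image_eq _ hm.injective, map_add_left_eq_self] at this
    rw [← this, ← h, tet_hull _ _ _ _ b rfl rfl rfl rfl, Set.image_image]
    rfl
  have : (volume : Measure (ℝ × ℝ × ℝ)).IsAddHaarMeasure := by
    have h2 : (volume : Measure (ℝ × ℝ)).IsAddHaarMeasure := inferInstance
    exact Measure.prod.instIsAddHaarMeasure (volume : Measure ℝ) (volume : Measure (ℝ × ℝ))
  have key := haar_pull volume volume Le T3 _ h0
  have e2 : ∀ z, Le z = z.1 • (b 1 - b 0) + z.2.1 • (b 2 - b 0) + z.2.2 • (b 3 - b 0) := fun z => L3_apply _ _ _ z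
  simp only [e2, hp.bary] at key
  set b0 := p (b 0)
  set b1 := p (b 1)
  set b2 := p (b 2)
  set b3 := p (b 3)
  set a01 := sd p (b 0) (b 1)
  set a02 := sd p (b 0) (b 2)
  set a03 := sd p (b 0) (b 3)
  set a12 := sd p (b 1) (b 2)
  set a13 := sd p (b 1) (b 3)
  set a23 := sd p (b 2) (b 3)
  have i0 := T3_int b0 (b1-b0+a01) (b2-b0+a02) (b3-b0+a03) (-a01) (-a02) (-a03) (a12-a01-a02) (a13-a01-a03) (a23-a02-a03)
  have j0 := key.symm.trans (Eq.trans (by congr 1; funext y; ring) i0)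
  linarith

lemma sum4 (f : Fin 4 → ℝ) (i : Fin 4) (hs : f 0 + f 1 + f 2 + f 3 = 0) (h : ∀ n, n ≠ i → f n = 0) : f i = 0 := by
  rw [← Fin.sum_univ_four, Finset.sum_eq_single i (fun n _ hn => h n hn) (by simp)] at hs
  exact hs

lemma algebra_lemma (β : Fin 4 → Fin 4 → Fin 4 → ℝ) (α : Fin 4 → Fin 4 → Fin 4 → Fin 4 → ℝ)
    (α1 : ∀ j k m i, α j k m i = α k j m i) (α2 : ∀ j k m i, α j k m i = α j k i m) (β2 : ∀ j m i, β j m i = β j i m)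
    (hz : ∀ j k m i, j ≠ k → m ≠ j → m ≠ k → i ≠ j → i ≠ k → α j k m i = 0)
    (hx : ∀ j k i, j ≠ k → i ≠ j → i ≠ k → α j k j i + α j k k i = 0)
    (hf : ∀ i j k l m, i ≠ j → i ≠ k → i ≠ l → j ≠ k → j ≠ l → k ≠ l →
      20 * β j m i = -(3 * α j k m i + 3 * α j l m i - α k l m i))
    (hi : ∀ m i, 5 * (β 0 m i + β 1 m i + β 2 m i + β 3 m i) +
      (α 0 1 m i + α 0 2 m i + α 0 3 m i + α 1 2 m i + α 1 3 m i + α 2 3 m i) = 0)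
    (hsa : ∀ j k i, α j k 0 i + α j k 1 i + α j k 2 i + α j k 3 i = 0)
    (hsb : ∀ j i, β j 0 i + β j 1 i + β j 2 i + β j 3 i = 0) :
    (∀ j m i, β j m i = 0) ∧ (∀ j k m i, j ≠ k → α j k m i = 0) := by
  have anti : ∀ j k i, j ≠ k → i ≠ j → i ≠ k → α j k k i = - α k j j i := by
    intro j k i h1 h2 h3
    have := hx j k i h1 h2 h3
    rw [α1 k j j i]; linarith
  have s1 : ∀ i j m l, i ≠ j → i ≠ m → i ≠ l → j ≠ m → j ≠ l → m ≠ l → α j m m i = α j i i m := by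
    intro i j m l h1 h2 h3 h4 h5 h6
    have a1 := hf i j m l m h1 h2 h3 h4 h5 h6
    have a2 := hf m j i l i h4.symm h2.symm h6 h1.symm h5 h3
    have b1 := hf i l m j m h3 h2 h1 h6.symm h5.symm h4.symm
    have b2 := hf m l i j i h6 h2.symm h4.symm h3.symm h5.symm h1
    have c1 := β2 j m i
    have c2 := β2 l m i
    have d1 := hz j l m i h5 h4.symm h6 h1 h3
    have d2 := α2 j l m i
    have d3 := α1 j l m i
    have d4 := α1 j l i m
    have e1 := hx m l i h6 h2 h3
    have e2 := hx j m i h4 h1 h2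
    have e3 := hx i l m h3 h2.symm h6
    have e4 := hx j i m h1.symm h4.symm h2.symm
    have f1 := α1 m l m i
    have f2 := α1 m j m i
    have f3 := α1 i l i m
    have f4 := α1 i j i m
    linarith
  have X0 : ∀ j m i, j ≠ m → i ≠ j → i ≠ m → α j m m i = 0 := by
    intro j m i h1 h2 h3
    obtain ⟨l, l1, l2, l3⟩ : ∃ l : Fin 4, l ≠ j ∧ l ≠ m ∧ l ≠ i := by
      clear * -
      revert j m i; decide
    have a1 := s1 i j m l h2 h3 l3.symm h1 l1.symm l2.symm
    have a2 := anti j i m h2.symm h1.symm h3.symm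
    have a3 := s1 m i j l h3.symm h1.symm l2.symm h2 l3.symm l1.symm
    have a3' := s1 j i m l h2.symm h1 l1.symm h3 l3.symm l2.symm
    have a4 := anti i m j h3 h2.symm h1
    have a5 := s1 j m i l h1 h2.symm l1.symm h3.symm l2.symm l3.symm
    have a6 := anti m j i h1.symm h3 h2
    linarith
  have A0 : ∀ j k m i, j ≠ k → i ≠ j → i ≠ k → α j k m i = 0 := by
    intro j k m i h1 h2 h3
    by_cases hk : m = k
    · subst hk; exact X0 _ _ _ h1 h2 h3
    by_cases hj : m = j
    · subst hj; rw [α1]; exact X0 _ _ _ h1.symm h3 h2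
    exact hz j k m i h1 hj hk h2 h3
  have A0' : ∀ j k m i, j ≠ k → m ≠ j → m ≠ k → α j k m i = 0 := by
    intro j k m i h1 h2 h3
    rw [α2]; exact A0 _ _ _ _ h1 h2 h3
  have B0 : ∀ j m i, i ≠ j → β j m i = 0 := by
    intro j m i h
    obtain ⟨k, l, h1, h2, h3, h4, h5⟩ : ∃ k l : Fin 4, i ≠ k ∧ i ≠ l ∧ j ≠ k ∧ j ≠ l ∧ k ≠ l := by
      clear * - h
      revert j i; decide
    have := hf i j k l m h h1 h2 h3 h4 h5
    rw [A0 j k m i h3 h h1, A0 j l m i h4 h h2, A0 k l m i h5 h1 h2] at this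
    linarith
  have B1 : ∀ j m i, β j m i = 0 := by
    intro j m i
    by_cases h : i = j
    · by_cases h' : m = j
      · subst h h'
        exact sum4 (fun n => β m n m) m (hsb m m) (fun n hn => by rw [β2]; exact B0 _ _ _ hn)
      · rw [β2]; exact B0 _ _ _ h'
    · exact B0 _ _ _ h
  refine ⟨B1, ?_⟩
  have C0 : ∀ j k, j ≠ k → α j k k j = 0 := by
    intro j k h
    have := hi k j
    simp only [B1] at this
    have z := α1 j k k j
    fin_cases j <;> fin_cases k <;> first | exact absurd rfl h | (simp [A0, A0'] at this z ⊢; linarith)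
  intro j k m i h
  by_cases h1 : i = j
  · subst h1
    by_cases h2 : m = i
    · subst h2
      refine sum4 (fun n => α m k n m) m (hsa m k m) fun n hn => ?_
      have z : α m k n m = 0 := by
        by_cases hk : n = k
        · subst hk; exact C0 _ _ h
        · exact A0' _ _ _ _ h hn hk
      exact z
    · by_cases hk : m = k
      · subst hk; exact C0 _ _ h
      · exact A0' _ _ _ _ h h2 hk
  · by_cases h3 : i = k
    · subst h3
      by_cases h2 : m = i
      · subst h2
        refine sum4 (fun n => α j m n m) m (hsa j m m) fun n hn => ?_
        have z : α j m n m = 0 := by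
          by_cases hk : n = j
          · subst hk; rw [α1]; exact C0 _ _ h.symm
          · exact A0' _ _ _ _ h hk hn
        exact z
      · by_cases hk : m = j
        · subst hk; rw [α1]; exact C0 _ _ h.symm
        · exact A0' _ _ _ _ h hk h2
    · exact A0 _ _ _ _ h h1 h3

lemma mem_tet (v : Fin 4 → E3) (j : Fin 4) : v j ∈ Tet v := subset_convexHull ℝ _ ⟨j, rfl⟩

lemma mid_tet (v : Fin 4 → E3) (j k : Fin 4) : (1/2 : ℝ) • v j + (1/2 : ℝ) • v k ∈ Tet v :=
  (convex_convexHull ℝ _) (mem_tet v j) (mem_tet v k) (by norm_num) (by norm_num) (by norm_num)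

lemma sd_sum {ι : Type*} (s : Finset ι) (f : ι → E3 → ℝ) (x y : E3) :
    sd (fun z => ∑ i ∈ s, f i z) x y = ∑ i ∈ s, sd (f i) x y := by
  simp only [sd, Finset.mul_sum, ← Finset.sum_sub_distrib]

lemma sd_cmul (c : ℝ) (f : E3 → ℝ) (x y : E3) :
    sd (fun z => c * f z) x y = c * sd f x y := by
  simp only [sd]; ring

/-- The bilinear evaluation `uᵀ σ w`. -/
def bil (σ : E3 → Matrix (Fin 3) (Fin 3) ℝ) (u w : Fin 3 → ℝ) (x : E3) : ℝ := u ⬝ᵥ (σ x *ᵥ w)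

lemma bil_eq (σ : E3 → Matrix (Fin 3) (Fin 3) ℝ) (u w : Fin 3 → ℝ) :
    bil σ u w = fun x => ∑ r, ∑ s, (u r * w s) * σ x r s := by
  funext x
  simp only [bil, dotProduct, mulVec, Finset.mul_sum]
  refine Finset.sum_congr rfl fun r _ => Finset.sum_congr rfl fun s _ => by ring

lemma bil_quad {σ : E3 → Matrix (Fin 3) (Fin 3) ℝ} (h : ∀ i j : Fin 3, IsPolyLE 2 (fun x => σ x i j))
    (u w : Fin 3 → ℝ) : IsQuad (bil σ u w) := by
  rw [bil_eq]
  exact IsQuad.sum _ _ fun r _ => IsQuad.sum _ _ fun s _ => (h r s).isQuad.cmul _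

lemma bil_symm {σ : E3 → Matrix (Fin 3) (Fin 3) ℝ} (u w : Fin 3 → ℝ) (x : E3) (h : (σ x).IsSymm) :
    bil σ u w x = bil σ w u x := by
  unfold bil
  rw [dotProduct_mulVec, ← mulVec_transpose, h.eq, dotProduct_comm]

lemma sd_affine {f : E3 → ℝ} {u w : E3} (h : AffineOn (segment ℝ u w) f) : sd f u w = 0 := by
  obtain ⟨q, hq⟩ := h
  have hm : (1/2 : ℝ) • u + (1/2 : ℝ) • w ∈ segment ℝ u w :=
    ⟨1/2, 1/2, by norm_num, by norm_num, by norm_num, rfl⟩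
  unfold sd
  rw [hq _ hm, hq _ (left_mem_segment ℝ u w), hq _ (right_mem_segment ℝ u w)]
  have : (1/2 : ℝ) • u + (1/2 : ℝ) • w = AffineMap.lineMap u w (1/2 : ℝ) := by
    rw [AffineMap.lineMap_apply_module]; norm_num
  rw [this, AffineMap.apply_lineMap, AffineMap.lineMap_apply_module]
  simp only [smul_eq_mul]; ring

lemma Qmat_mulVec (s : E3) (u : Fin 3 → ℝ) (h : u ⬝ᵥ (fun i => s i) = 0) : Qmat s *ᵥ u = u := by
  unfold Qmat
  rw [sub_mulVec, one_mulVec, vecMulVec_mulVec]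
  rw [dotProduct_comm] at h
  simp [h]

lemma Qmat_vecMul (s : E3) (u : Fin 3 → ℝ) (h : u ⬝ᵥ (fun i => s i) = 0) : u ᵥ* Qmat s = u := by
  unfold Qmat
  rw [vecMul_sub, vecMul_one, vecMul_vecMulVec]
  simp [h]

lemma edge_lemma {v : Fin 4 → E3} {σ : E3 → Matrix (Fin 3) (Fin 3) ℝ} (hσ : MemSigmaK v σ)
    (j k : Fin 4) (hjk : j ≠ k) (hne : v k - v j ≠ 0) (u w : Fin 3 → ℝ)
    (hu : u ⬝ᵥ (fun r => (v k - v j) r) = 0) (hw : w ⬝ᵥ (fun r => (v k - v j) r) = 0) :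
    sd (bil σ u w) (v j) (v k) = 0 := by
  set t := v k - v j with ht
  have hn : ‖t‖ ≠ 0 := norm_ne_zero_iff.2 hne
  set s : E3 := ‖t‖⁻¹ • t with hs
  have hsn : ‖s‖ = 1 := by rw [hs, norm_smul, norm_inv, norm_norm, inv_mul_cancel₀ hn]
  have hts : t = ‖t‖ • s := by rw [hs, smul_smul, mul_inv_cancel₀ hn, one_smul]
  have e : ∀ y : Fin 3 → ℝ, y ⬝ᵥ (fun r => t r) = 0 → y ⬝ᵥ (fun r => s r) = 0 := by
    intro y hy
    have : (fun r => s r) = ‖t‖⁻¹ • (fun r => t r) := by funext r; simp [hs]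
    rw [this, dotProduct_smul, hy, smul_zero]
  have hA := hσ.2.2 j k hjk s hsn ⟨‖t‖, hts⟩
  have hb : bil σ u w = bil (fun x => Qmat s * σ x * Qmat s) u w := by
    funext x
    unfold bil
    rw [← mulVec_mulVec, ← mulVec_mulVec, Qmat_mulVec s w (e w hw), dotProduct_mulVec u (Qmat s),
      Qmat_vecMul s u (e u hu)]
  rw [hb, bil_eq, sd_sum]
  refine Finset.sum_eq_zero fun r _ => ?_
  rw [sd_sum]
  refine Finset.sum_eq_zero fun q _ => ?_
  rw [sd_cmul, sd_affine (hA r q), mul_zero]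

/-- Gradient of a barycentric coordinate. -/
def grad (b : AffineBasis (Fin 4) ℝ E3) (i : Fin 4) : Fin 3 → ℝ :=
  fun r => (b.coord i).linear (EuclideanSpace.single r 1)

lemma grad_dot (b : AffineBasis (Fin 4) ℝ E3) (i : Fin 4) (y : E3) :
    grad b i ⬝ᵥ (fun r => y r) = (b.coord i).linear y := by
  have : y = ∑ r, y r • EuclideanSpace.single r (1 : ℝ) := by
    ext r
    simp [Finset.sum_apply, Pi.single_apply]
  conv_rhs => rw [this, map_sum]
  simp only [map_smul, dotProduct, grad, smul_eq_mul]
  exact Finset.sum_congr rfl fun r _ => mul_comm _ _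

lemma grad_dot_sub (b : AffineBasis (Fin 4) ℝ E3) (i : Fin 4) (x y : E3) :
    grad b i ⬝ᵥ (fun r => (x - y) r) = b.coord i x - b.coord i y := by
  rw [grad_dot, ← vsub_eq_sub, AffineMap.linearMap_vsub]; rfl

lemma grad_sum (b : AffineBasis (Fin 4) ℝ E3) : grad b 0 + grad b 1 + grad b 2 + grad b 3 = 0 := by
  funext r
  have h (y : E3) : b.coord 0 y + b.coord 1 y + b.coord 2 y + b.coord 3 y = 1 := by
    rw [← Fin.sum_univ_four (fun i => b.coord i y)]; exact b.sum_coord_apply_eq_one y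
  have e (i : Fin 4) : grad b i r = b.coord i (EuclideanSpace.single r 1) - b.coord i 0 := by
    rw [← vsub_eq_sub, ← AffineMap.linearMap_vsub]; simp [grad]
  have h1 := h (EuclideanSpace.single r 1)
  have h0 := h 0
  simp only [Pi.add_apply, e, Pi.zero_apply]
  linarith

lemma grad_ext (b : AffineBasis (Fin 4) ℝ E3) (y : Fin 3 → ℝ) (h : ∀ i, grad b i ⬝ᵥ y = 0) : y = 0 := by
  have h1 : WithLp.toLp 2 y = (0 : E3) := by
    apply b.ext_elem
    intro i
    have := grad_dot_sub b i (WithLp.toLp 2 y) 0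
    simp only [sub_zero] at this
    have h2 := h i
    have : grad b i ⬝ᵥ y = _ := this
    linarith
  funext r
  have := congrArg (fun z : E3 => z r) h1
  simpa using this

lemma grad_mat (b : AffineBasis (Fin 4) ℝ E3) (A : Matrix (Fin 3) (Fin 3) ℝ)
    (h : ∀ m i, grad b m ⬝ᵥ (A *ᵥ grad b i) = 0) : A = 0 := by
  have h1 : ∀ i, A *ᵥ grad b i = 0 := fun i => grad_ext b _ fun m => h m i
  ext r s
  have h2 : A r = 0 := grad_ext b _ fun i => by
    rw [dotProduct_comm]; exact congrFun (h1 i) r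
  rw [h2]; rfl

lemma normal_exists (b : AffineBasis (Fin 4) ℝ E3) (i : Fin 4) :
    ∃ c : ℝ, c ≠ 0 ∧ ∃ n : E3, IsOutwardNormal b i n ∧ (fun r => n r) = c • grad b i := by
  set G : E3 := WithLp.toLp 2 (grad b i) with hG
  have hinner (y : E3) : ⟪y, G⟫ = grad b i ⬝ᵥ (fun r => y r) := by
    simp [PiLp.inner_apply, dotProduct, hG]
  have hj : ∃ j : Fin 4, j ≠ i := exists_ne i
  obtain ⟨j, hj⟩ := hj
  have hG0 : G ≠ 0 := by
    intro h0
    have := hinner (b i - b j)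
    rw [h0, inner_zero_right, grad_dot_sub, b.coord_apply_eq, b.coord_apply_ne hj.symm] at this
    norm_num at this
  have hGn : 0 < ‖G‖ := norm_pos_iff.2 hG0
  refine ⟨-‖G‖⁻¹, neg_ne_zero.2 (inv_ne_zero hGn.ne'), (-‖G‖⁻¹) • G, ⟨?_, ?_, ?_⟩, ?_⟩
  · rw [norm_smul, norm_neg, norm_inv, norm_norm, inv_mul_cancel₀ hGn.ne']
  · intro j k hj hk
    rw [inner_smul_right, hinner, grad_dot_sub, b.coord_apply_ne hj.symm, b.coord_apply_ne hk.symm]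
    simp
  · intro j hj
    rw [inner_smul_right, hinner, grad_dot_sub, b.coord_apply_eq, b.coord_apply_ne hj.symm]
    have := inv_pos.2 hGn
    linarith
  · funext r
    simp [hG]

lemma face_eq (v : Fin 4 → E3) (i j k l : Fin 4) (h1 : i ≠ j) (h2 : i ≠ k) (h3 : i ≠ l) (h4 : j ≠ k)
    (h5 : j ≠ l) (h6 : k ≠ l) : Face v i = convexHull ℝ {v j, v k, v l} := by
  have : {x : Fin 4 | x ≠ i} = {j, k, l} := by
    ext x
    simp only [Set.mem_ofPred_eq, Set.mem_insert_iff, Set.mem_singleton_iff]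
    clear * - h1 h2 h3 h4 h5 h6
    revert i j k l x; decide
  unfold Face
  rw [this, Set.image_insert_eq, Set.image_insert_eq, Set.image_singleton]

lemma integral_bil {σ : E3 → Matrix (Fin 3) (Fin 3) ℝ} {S : Set E3} (hS : IsCompact S)
    (h : ∀ i j : Fin 3, IsPolyLE 2 (fun x => σ x i j)) (hint : ∀ i j : Fin 3, (∫ x in S, σ x i j) = 0)
    (u w : Fin 3 → ℝ) : ∫ x in S, bil σ u w x = 0 := by
  have hc : ∀ r s, IntegrableOn (fun x => σ x r s) S := by
    intro r s
    obtain ⟨a0, a1, a2, a3, a4, a5, a6, a7, a8, a9, ha⟩ := (h r s).isQuad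
    have : Continuous (fun x => σ x r s) := by
      rw [show (fun x => σ x r s) = _ from funext ha]
      fun_prop
    exact this.continuousOn.integrableOn_compact hS
  rw [bil_eq, integral_finsetSum]
  · refine Finset.sum_eq_zero fun r _ => ?_
    rw [integral_finsetSum]
    · refine Finset.sum_eq_zero fun s _ => ?_
      rw [integral_const_mul, hint, mul_zero]
    · exact fun s _ => (hc r s).const_mul _
  · exact fun r _ => integrable_finsetSum _ fun s _ => (hc r s).const_mul _

lemma bil_add_left (σ : E3 → Matrix (Fin 3) (Fin 3) ℝ) (u u' w : Fin 3 → ℝ) (x : E3) :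
    bil σ (u + u') w x = bil σ u w x + bil σ u' w x := by
  simp [bil, add_dotProduct]

lemma sd_bil_add_left (σ : E3 → Matrix (Fin 3) (Fin 3) ℝ) (u u' w : Fin 3 → ℝ) (x y : E3) :
    sd (bil σ (u + u') w) x y = sd (bil σ u w) x y + sd (bil σ u' w) x y := by
  simp only [sd, bil_add_left]; ring

lemma bil_zero_left (σ : E3 → Matrix (Fin 3) (Fin 3) ℝ) (w : Fin 3 → ℝ) (x : E3) :
    bil σ 0 w x = 0 := by
  simp [bil]

/-- Theorem 3.2 (unisolvence): if `σ ∈ Σ_K` has vanishing face degrees of freedom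
`∫_f σ n_f · v ds = 0` for all `v ∈ P₁(f;ℝ³)` and all faces `f`, and vanishing
interior degrees of freedom `∫_K σ dx = 0`, then `σ = 0` on `K`. -/
theorem stmt_4 (v : Fin 4 → E3) (hv : AffineIndependent ℝ v)
    (σ : E3 → Matrix (Fin 3) (Fin 3) ℝ) (hσ : MemSigmaK v σ)
    (hface : ∀ i : Fin 4, ∀ n : E3, IsOutwardNormal v i n →
      ∀ w : Fin 3 → (E3 →ᵃ[ℝ] ℝ),
        ∫ x in Face v i, ((σ x).mulVec (fun r => n r)) ⬝ᵥ (fun r => w r x) ∂μH[2] = 0)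
    (hint : ∀ i j : Fin 3, (∫ x in Tet v, σ x i j) = 0) :
    ∀ x ∈ Tet v, σ x = 0 := by
  obtain ⟨b, hb⟩ : ∃ b : AffineBasis (Fin 4) ℝ E3, (b : Fin 4 → E3) = v :=
    ⟨⟨v, hv, hv.affineSpan_eq_top_iff_card_eq_finrank_add_one.2 (by simp)⟩, rfl⟩
  subst hb
  obtain ⟨hpoly, hsymm, -⟩ := id hσ
  have hq := fun u w => bil_quad hpoly u w
  have hcompact : IsCompact (Tet b) := (Set.finite_range b).isCompact_convexHull ℝ
  have edge : ∀ j k, j ≠ k → ∀ u w : Fin 3 → ℝ, u ⬝ᵥ (fun r => (b k - b j) r) = 0 →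
      w ⬝ᵥ (fun r => (b k - b j) r) = 0 → sd (bil σ u w) (b j) (b k) = 0 := fun j k hjk u w =>
    edge_lemma hσ j k hjk (sub_ne_zero.2 fun h => hjk (hv.injective h).symm) u w
  have hfaces : ∀ i j k l, i ≠ j → i ≠ k → i ≠ l → j ≠ k → j ≠ l → k ≠ l → ∀ u : Fin 3 → ℝ,
      20 * bil σ u (grad b i) (b j) = -(3 * sd (bil σ u (grad b i)) (b j) (b k)
        + 3 * sd (bil σ u (grad b i)) (b j) (b l) - sd (bil σ u (grad b i)) (b k) (b l)) := by
    intro i j k l h1 h2 h3 h4 h5 h6 u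
    refine face_lemma (hq _ _) _ _ _ (b.coord k) (b.coord l) (b.coord_apply_ne h4.symm) (b.coord_apply_eq k)
      (b.coord_apply_ne h6) (b.coord_apply_ne h5.symm) (b.coord_apply_ne h6.symm) (b.coord_apply_eq l) ?_
    intro q
    obtain ⟨c, hc, n, hn, hnc⟩ := normal_exists b i
    have := hface i n hn (fun r => u r • q)
    rw [face_eq b i j k l h1 h2 h3 h4 h5 h6, hnc] at this
    have e : ∀ x, ((σ x).mulVec (c • grad b i)) ⬝ᵥ (fun r => (u r • q) x) = c * (bil σ u (grad b i) x * q x) := by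
      intro x
      have : (fun r => (u r • q) x) = (q x) • u := by funext r; simp [mul_comm]
      rw [this, mulVec_smul, smul_dotProduct, dotProduct_smul, dotProduct_comm]
      simp only [bil, smul_eq_mul]; ring
    simp only [e] at this
    rw [integral_const_mul] at this
    exact (mul_eq_zero.1 this).resolve_left hc
  have hsum := grad_sum b
  obtain ⟨B0, A0⟩ := algebra_lemma (fun j m i => bil σ (grad b m) (grad b i) (b j))
    (fun j k m i => sd (bil σ (grad b m) (grad b i)) (b j) (b k))
    (fun j k m i => sd_comm _ _ _)
    (fun j k m i => by
      simp only [sd]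
      rw [bil_symm _ _ _ (hsymm _ (mid_tet b j k)), bil_symm _ _ _ (hsymm _ (mem_tet b j)),
        bil_symm _ _ _ (hsymm _ (mem_tet b k))])
    (fun j m i => bil_symm _ _ _ (hsymm _ (mem_tet b j)))
    (fun j k m i h1 h2 h3 h4 h5 => edge j k h1 _ _
      (by rw [grad_dot_sub, b.coord_apply_ne h2, b.coord_apply_ne h3, sub_zero])
      (by rw [grad_dot_sub, b.coord_apply_ne h4, b.coord_apply_ne h5, sub_zero]))
    (fun j k i h1 h2 h3 => by
      rw [← sd_bil_add_left]
      refine edge j k h1 _ _ ?_ ?_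
      · rw [add_dotProduct, grad_dot_sub, grad_dot_sub, b.coord_apply_eq, b.coord_apply_eq,
          b.coord_apply_ne h1, b.coord_apply_ne h1.symm]
        norm_num
      · rw [grad_dot_sub, b.coord_apply_ne h2, b.coord_apply_ne h3, sub_zero])
    (fun i j k l m h1 h2 h3 h4 h5 h6 => hfaces i j k l h1 h2 h3 h4 h5 h6 _)
    (fun m i => tet_lemma (hq _ _) b (integral_bil hcompact hpoly hint _ _))
    (fun j k i => by
      simp only [← sd_bil_add_left, hsum]
      simp [sd, bil_zero_left])
    (fun j i => by
      simp only [← bil_add_left, hsum, bil_zero_left])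
  have A0 : ∀ j k, j ≠ k → ∀ m i, sd (bil σ (grad b m) (grad b i)) (b j) (b k) = 0 :=
    fun j k h m i => A0 j k m i h
  intro x _
  refine grad_mat b _ fun m i => ?_
  change bil σ (grad b m) (grad b i) x = 0
  have hx : x = b 0 + (b.coord 1 x • (b 1 - b 0) + b.coord 2 x • (b 2 - b 0) + b.coord 3 x • (b 3 - b 0)) := by
    have hs := b.sum_coord_apply_eq_one x
    rw [Fin.sum_univ_four] at hs
    have := b.linear_combination_coord_eq_self x
    rw [Fin.sum_univ_four, show b.coord 0 x = 1 - b.coord 1 x - b.coord 2 x - b.coord 3 x by linarith] at this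
    conv_lhs => rw [← this]
    module
  rw [hx, (hq _ _).bary, A0 0 1 (by decide), A0 0 2 (by decide), A0 0 3 (by decide), A0 1 2 (by decide),
    A0 1 3 (by decide), A0 2 3 (by decide)]
  rw [B0, B0, B0, B0]
  ring
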